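/- (a) For every x ∈ ℂ with −π/2 − fπ/k < Im x < π/2 − fπ/k, the function η ↦ Γ(c − iη)^k · exp(iπf·(−c + iη)) · exp(k·(−c + iη)·x) is integrable on ℝ. (b) The function G(x) := ∫_ℝ Γ(c − iη)^k · exp(iπf·(−c + iη)) · exp(k·(−c + iη)·x) dη is holomorphic on the open strip {x ∈ ℂ : −π/2 − fπ/k < Im x < π/2 − fπ/k} and satisfies there the generalized hypergeometric equation in logarithmic form, G^{(k)}(x) = k^k · e^{kx} · G(x), where G^{(k)} is the k-th complex derivative. -/

import Mathlib

open Complex Real MeasureTheory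

/-- The Mellin–Barnes integrand `Γ(c-iη)^k · e^{iπf(-c+iη)} · e^{k(-c+iη)x}` with
`f = k + 2m`, written in the logarithmic variable `x` (`z = e^x`). -/
noncomputable def mbIntegrand (k : ℕ) (m : ℤ) (c : ℝ) (x : ℂ) (η : ℝ) : ℂ :=
  Complex.Gamma ((c : ℂ) - Complex.I * η) ^ k *
    Complex.exp (Complex.I * (π : ℂ) * ((k : ℂ) + 2 * (m : ℂ)) * (-(c : ℂ) + Complex.I * η)) *
    Complex.exp ((k : ℂ) * (-(c : ℂ) + Complex.I * η) * x)

/-- The Mellin–Barnes integral `G(x)` (the solution `g(z)` of Lemma 5 of the paper up to a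
nonzero constant, in the variable `z = e^x`). -/
noncomputable def mbG (k : ℕ) (m : ℤ) (c : ℝ) (x : ℂ) : ℂ :=
  ∫ η : ℝ, mbIntegrand k m c x η

/-- The strip `-π/2 - fπ/k < Im x < π/2 - fπ/k`, `f = k + 2m`. -/
def mbStrip (k : ℕ) (m : ℤ) : Set ℂ :=
  {x : ℂ | -(π / 2) - ((k : ℝ) + 2 * m) * π / k < x.im ∧
    x.im < π / 2 - ((k : ℝ) + 2 * m) * π / k}

open Set Filter Topology

/-- The Beta integral is dominated by its value at the real parts of its arguments. -/
lemma norm_betaIntegral_le (u v : ℂ) :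
    ‖Complex.betaIntegral u v‖ ≤ ‖Complex.betaIntegral u.re v.re‖ := by
  have key : ∀ u v : ℂ, ∀ x ∈ Ioo (0 : ℝ) 1,
      ‖(x : ℂ) ^ (u - 1) * (1 - (x : ℂ)) ^ (v - 1)‖ = x ^ (u.re - 1) * (1 - x) ^ (v.re - 1) := by
    intro u v x hx
    have hx' : 0 < 1 - x := sub_pos.2 hx.2
    rw [norm_mul, Complex.norm_cpow_eq_rpow_re_of_pos hx.1, ← Complex.ofReal_one,
      ← Complex.ofReal_sub, Complex.norm_cpow_eq_rpow_re_of_pos hx']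
    simp
  have hreal : Complex.betaIntegral u.re v.re =
      ((∫ x in Ioo (0 : ℝ) 1, x ^ (u.re - 1) * (1 - x) ^ (v.re - 1) : ℝ) : ℂ) := by
    rw [Complex.betaIntegral, intervalIntegral.integral_of_le zero_le_one,
      integral_Ioc_eq_integral_Ioo, ← integral_complex_ofReal]
    refine setIntegral_congr_fun measurableSet_Ioo fun x hx => ?_
    have hx' : 0 ≤ 1 - x := sub_nonneg.2 hx.2.le
    simp [Complex.ofReal_cpow hx.1.le, Complex.ofReal_cpow hx']
  rw [hreal, Complex.norm_real, Complex.betaIntegral,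
    intervalIntegral.integral_of_le zero_le_one, integral_Ioc_eq_integral_Ioo]
  refine (norm_integral_le_integral_norm _).trans ((le_abs_self _).trans_eq ?_)
  rw [setIntegral_congr_fun measurableSet_Ioo (key u v), Real.norm_eq_abs]

/-- `‖Γ(w)‖ / Γ(Re w)` does not decrease when `w` is translated to the right. -/
lemma norm_Gamma_le_norm_Gamma_add {w : ℂ} (hw : 0 < w.re) {t : ℝ} (ht : 0 < t) :
    ‖Complex.Gamma w‖ ≤ Real.Gamma w.re / Real.Gamma (w.re + t) * ‖Complex.Gamma (w + t)‖ := by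
  have h1 := Complex.Gamma_mul_Gamma_eq_betaIntegral (s := w) (t := t) hw (by simpa using ht)
  have h2 := Complex.Gamma_mul_Gamma_eq_betaIntegral (s := (w.re : ℂ)) (t := t)
    (by simpa using hw) (by simpa using ht)
  rw [← Complex.ofReal_add, Complex.Gamma_ofReal, Complex.Gamma_ofReal, Complex.Gamma_ofReal] at h2
  rw [Complex.Gamma_ofReal] at h1
  have h3 := norm_betaIntegral_le w t
  have n1 := congrArg norm h1
  have n2 := congrArg norm h2
  have p1 := Real.Gamma_pos_of_pos hw
  have p2 := Real.Gamma_pos_of_pos ht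
  have p3 := Real.Gamma_pos_of_pos (add_pos hw ht)
  simp only [norm_mul, Complex.norm_real, Real.norm_of_nonneg p1.le, Real.norm_of_nonneg p2.le,
    Real.norm_of_nonneg p3.le] at n1 n2
  simp only [Complex.ofReal_re] at h3
  rw [div_mul_eq_mul_div, le_div_iff₀ p3]
  refine le_of_mul_le_mul_right ?_ p2
  calc ‖Complex.Gamma w‖ * Real.Gamma (w.re + t) * Real.Gamma t
      = Real.Gamma (w.re + t) * (‖Complex.Gamma (w + t)‖ * ‖Complex.betaIntegral w t‖) := by
        rw [← n1]; ring
    _ ≤ Real.Gamma (w.re + t) *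
          (‖Complex.Gamma (w + t)‖ * ‖Complex.betaIntegral w.re t‖) := by gcongr
    _ = Real.Gamma w.re * ‖Complex.Gamma (w + t)‖ * Real.Gamma t := by
        linear_combination (-‖Complex.Gamma (w + t)‖) * n2

lemma norm_Gamma_half_add_le (η : ℝ) :
    ‖Complex.Gamma (1 / 2 + η * Complex.I)‖ ≤ √(2 * π) * Real.exp (-(π / 2) * |η|) := by
  have hconj : (starRingEnd ℂ) (1 / 2 + η * Complex.I) = 1 - (1 / 2 + η * Complex.I) := by
    apply Complex.ext <;> simp
    norm_num
  have h := Complex.Gamma_mul_Gamma_one_sub (1 / 2 + η * Complex.I)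
  rw [← hconj, Complex.Gamma_conj, Complex.mul_conj', mul_add,
    show (π : ℂ) * (1 / 2) = π / 2 by ring, add_comm (π / 2 : ℂ), Complex.sin_add_pi_div_two,
    ← mul_assoc, Complex.cos_mul_I] at h
  have h' : ‖Complex.Gamma (1 / 2 + η * Complex.I)‖ ^ 2 = π / Real.cosh (π * η) := by
    exact_mod_cast h
  have hcosh : Real.exp (π * |η|) / 2 ≤ Real.cosh (π * η) := by
    rw [← Real.cosh_abs, abs_mul, abs_of_pos Real.pi_pos, Real.cosh_eq]
    have := Real.exp_pos (-(π * |η|))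
    linarith
  refine le_of_sq_le_sq ?_ (by positivity)
  rw [h', mul_pow, Real.sq_sqrt (by positivity), ← Real.exp_nat_mul,
    div_le_iff₀ (Real.cosh_pos _)]
  calc π = 2 * π * Real.exp ((2 : ℕ) * (-(π / 2) * |η|)) * (Real.exp (π * |η|) / 2) := by
        rw [show 2 * π * Real.exp ((2 : ℕ) * (-(π / 2) * |η|)) * (Real.exp (π * |η|) / 2) =
          π * (Real.exp ((2 : ℕ) * (-(π / 2) * |η|)) * Real.exp (π * |η|)) by ring, ← Real.exp_add]
        push_cast
        ring_nf
        simp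
    _ ≤ _ := by gcongr

lemma exists_norm_Gamma_nat_add_half_le (N : ℕ) : ∃ C, 0 ≤ C ∧ ∀ η : ℝ,
    ‖Complex.Gamma (N + 1 / 2 + η * Complex.I)‖ ≤
      C * (1 + |η|) ^ N * Real.exp (-(π / 2) * |η|) := by
  induction N with
  | zero => exact ⟨√(2 * π), by positivity, fun η => by simpa using norm_Gamma_half_add_le η⟩
  | succ N ih =>
    obtain ⟨C, hC, h⟩ := ih
    refine ⟨(N + 1) * C, by positivity, fun η => ?_⟩
    have hne : (N + 1 / 2 + η * Complex.I : ℂ) ≠ 0 := fun h0 => by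
      have := congrArg Complex.re h0
      simp at this
      linarith [(Nat.cast_nonneg N : (0 : ℝ) ≤ N)]
    have hnorm : ‖(N + 1 / 2 + η * Complex.I : ℂ)‖ ≤ (N + 1) * (1 + |η|) := by
      refine (Complex.norm_le_abs_re_add_abs_im _).trans ?_
      have hN : (0 : ℝ) ≤ N := Nat.cast_nonneg N
      have : |(N : ℝ) + 2⁻¹| = N + 2⁻¹ := abs_of_nonneg (by positivity)
      simp [this]
      nlinarith [abs_nonneg η]
    rw [show ((N + 1 : ℕ) + 1 / 2 + η * Complex.I : ℂ) = N + 1 / 2 + η * Complex.I + 1 by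
      push_cast; ring, Complex.Gamma_add_one _ hne, norm_mul]
    calc _ ≤ (N + 1) * (1 + |η|) * (C * (1 + |η|) ^ N * Real.exp (-(π / 2) * |η|)) := by
          gcongr
          exact h η
      _ = _ := by ring

/-- Decay of the Gamma function in closed vertical strips of the right half-plane. -/
lemma exists_norm_Gamma_le {c : ℝ} (hc : 0 < c) (d : ℝ) : ∃ C, 0 ≤ C ∧ ∃ N : ℕ, ∀ w : ℂ,
    c ≤ w.re → w.re ≤ d →
      ‖Complex.Gamma w‖ ≤ C * (1 + |w.im|) ^ N * Real.exp (-(π / 2) * |w.im|) := by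
  obtain ⟨N, hN⟩ := exists_nat_ge d
  obtain ⟨C, hC, hb⟩ := exists_norm_Gamma_nat_add_half_le N
  obtain ⟨B, hB⟩ := (isCompact_Icc (a := c) (b := d)).exists_bound_of_continuousOn
    (Real.differentiableOn_Gamma_Ioi.continuousOn.mono fun x hx => hc.trans_le hx.1)
  have hpos : 0 < Real.Gamma (N + 1 / 2) := Real.Gamma_pos_of_pos (by positivity)
  refine ⟨|B| / Real.Gamma (N + 1 / 2) * C, by positivity, N, fun w h1 h2 => ?_⟩
  have h := norm_Gamma_le_norm_Gamma_add (hc.trans_le h1) (t := N + 1 / 2 - w.re) (by linarith)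
  rw [show w + ((N + 1 / 2 - w.re : ℝ) : ℂ) = N + 1 / 2 + w.im * Complex.I by
    apply Complex.ext <;> simp, add_sub_cancel] at h
  have hB' : Real.Gamma w.re ≤ |B| :=
    (le_abs_self _).trans ((hB w.re ⟨h1, h2⟩).trans (le_abs_self B))
  calc _ ≤ _ := h
    _ ≤ |B| / Real.Gamma (N + 1 / 2) *
        (C * (1 + |w.im|) ^ N * Real.exp (-(π / 2) * |w.im|)) := by
      gcongr
      exact hb w.im
    _ = _ := by ring

lemma exists_one_add_pow_le_exp (M : ℕ) {a : ℝ} (ha : 0 < a) : ∃ K, 0 ≤ K ∧ ∀ u : ℝ, 0 ≤ u →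
    (1 + u) ^ M ≤ K * Real.exp (a * u) := by
  refine ⟨M.factorial * Real.exp a / a ^ M, by positivity, fun u hu => ?_⟩
  have h := Real.pow_div_factorial_le_exp (x := a * (1 + u)) (by positivity) M
  rw [div_le_iff₀ (by positivity), mul_pow, mul_add, mul_one, Real.exp_add] at h
  rw [div_mul_eq_mul_div, le_div_iff₀ (by positivity)]
  linarith

/-- The Mellin–Barnes kernel `w ^ j * (Γ(w) e^{-wy}) ^ k`. -/
noncomputable def mbKernel (k j : ℕ) (y w : ℂ) : ℂ :=
  w ^ j * (Complex.Gamma w * Complex.exp (-(w * y))) ^ k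

lemma exists_norm_mbKernel_le {k : ℕ} (hk : 1 ≤ k) (j : ℕ) {c : ℝ} (hc : 0 < c) (d : ℝ)
    {δ : ℝ} (hδ : δ < π / 2) (R : ℝ) : ∃ K b, 0 < b ∧ ∀ y w : ℂ,
    |y.im| ≤ δ → |y.re| ≤ R → c ≤ w.re → w.re ≤ d →
      ‖mbKernel k j y w‖ ≤ K * Real.exp (-b * |w.im|) := by
  obtain ⟨C, hC, N, hΓ⟩ := exists_norm_Gamma_le hc d
  have ha : 0 < k * (π / 2 - δ) / 2 := by
    have : (0 : ℝ) < k := by exact_mod_cast hk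
    have := sub_pos.2 hδ
    positivity
  obtain ⟨P, hP, hpoly⟩ := exists_one_add_pow_le_exp (j + N * k) ha
  refine ⟨(1 + |d|) ^ j * (C * Real.exp (|d| * R)) ^ k * P, _, ha, fun y w hy hyR h1 h2 => ?_⟩
  have hw : ‖w‖ ≤ (1 + |d|) * (1 + |w.im|) := by
    refine (Complex.norm_le_abs_re_add_abs_im _).trans ?_
    rw [abs_of_pos (hc.trans_le h1)]
    nlinarith [abs_nonneg w.im, abs_nonneg d, le_abs_self d]
  have he : ‖Complex.exp (-(w * y))‖ ≤ Real.exp (|d| * R) * Real.exp (δ * |w.im|) := by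
    rw [Complex.norm_exp, ← Real.exp_add, Real.exp_le_exp]
    have e1 : |w.re * y.re| ≤ |d| * R := by
      rw [abs_mul, abs_of_pos (hc.trans_le h1)]
      gcongr
      exact h2.trans (le_abs_self d)
    have e2 : |w.im * y.im| ≤ δ * |w.im| := by
      rw [abs_mul, mul_comm]
      gcongr
    simp only [Complex.neg_re, Complex.mul_re]
    linarith [neg_abs_le (w.re * y.re), le_abs_self (w.im * y.im)]
  have hu := abs_nonneg w.im
  have hΓw := hΓ w h1 h2
  rw [mbKernel, norm_mul, norm_pow, norm_pow, norm_mul]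
  generalize |w.im| = u at *
  calc _ ≤ ((1 + |d|) * (1 + u)) ^ j * ((C * (1 + u) ^ N * Real.exp (-(π / 2) * u)) *
        (Real.exp (|d| * R) * Real.exp (δ * u))) ^ k := by
        gcongr
    _ = (1 + |d|) ^ j * (C * Real.exp (|d| * R)) ^ k * (1 + u) ^ (j + N * k) *
        (Real.exp (-(π / 2) * u) * Real.exp (δ * u)) ^ k := by
      rw [pow_add, pow_mul]
      simp only [mul_pow]
      ring
    _ ≤ (1 + |d|) ^ j * (C * Real.exp (|d| * R)) ^ k *
        (P * Real.exp (k * (π / 2 - δ) / 2 * u)) *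
        (Real.exp (-(π / 2) * u) * Real.exp (δ * u)) ^ k := by
      gcongr
      exact hpoly u hu
    _ = _ := by
      rw [← Real.exp_add, ← Real.exp_nat_mul, ← mul_assoc, mul_assoc _ (Real.exp _),
        ← Real.exp_add]
      ring_nf

lemma integrable_exp_neg_mul_abs {b : ℝ} (hb : 0 < b) :
    Integrable fun η : ℝ => Real.exp (-b * |η|) := by
  rw [← integrableOn_univ, ← Iic_union_Ioi (a := (0 : ℝ))]
  refine IntegrableOn.union ?_ ?_
  · refine (integrableOn_exp_mul_Iic hb 0).congr_fun (fun x hx => ?_) measurableSet_Iic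
    simp [abs_of_nonpos (mem_Iic.1 hx)]
  · refine (integrableOn_exp_mul_Ioi (neg_neg_of_pos hb) 0).congr_fun (fun x hx => ?_)
      measurableSet_Ioi
    simp [abs_of_pos (mem_Ioi.1 hx)]

/-- Shift of a vertical line of integration for an exponentially decaying function. -/
lemma integral_vertical_eq_of_norm_le {F : ℂ → ℂ} {c d K b : ℝ} (hcd : c ≤ d) (hb : 0 < b)
    (hF : ∀ w : ℂ, c ≤ w.re → w.re ≤ d → DifferentiableAt ℂ F w)
    (hbound : ∀ w : ℂ, c ≤ w.re → w.re ≤ d → ‖F w‖ ≤ K * Real.exp (-b * |w.im|)) :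
    ∫ η : ℝ, F (c + η * Complex.I) = ∫ η : ℝ, F (d + η * Complex.I) := by
  have hF_int : ∀ σ : ℝ, c ≤ σ → σ ≤ d → Integrable fun η : ℝ => F (σ + η * Complex.I) := by
    intro σ h1 h2
    refine ((integrable_exp_neg_mul_abs hb).const_mul K).mono' ?_ (ae_of_all _ fun η => ?_)
    · refine Continuous.aestronglyMeasurable (continuous_iff_continuousAt.2 fun η => ?_)
      exact ContinuousAt.comp (g := F) (f := fun η : ℝ => (σ + η * Complex.I : ℂ))
        (hF _ (by simpa) (by simpa)).continuousAt (by fun_prop)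
    · simpa using hbound (σ + η * Complex.I) (by simpa) (by simpa)
  have hlim : ∀ σ : ℝ, c ≤ σ → σ ≤ d → Tendsto (fun T : ℝ => ∫ η in (-T)..T,
      F (σ + η * Complex.I)) atTop (𝓝 (∫ η : ℝ, F (σ + η * Complex.I))) := fun σ h1 h2 =>
    intervalIntegral_tendsto_integral (hF_int σ h1 h2) tendsto_neg_atTop_atBot tendsto_id
  have hexp : Tendsto (fun T : ℝ => K * Real.exp (-b * T) * |d - c|) atTop (𝓝 0) := by
    have : Tendsto (fun T : ℝ => Real.exp (-b * T)) atTop (𝓝 0) :=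
      Real.tendsto_exp_atBot.comp (tendsto_id.const_mul_atTop_of_neg (neg_neg_of_pos hb))
    simpa using (this.const_mul K).mul_const |d - c|
  have hside : ∀ s : ℝ, |s| = 1 → Tendsto (fun T : ℝ => ∫ σ in c..d,
      F (σ + (s * T : ℝ) * Complex.I)) atTop (𝓝 0) := by
    intro s hs
    refine squeeze_zero_norm' ?_ hexp
    filter_upwards [eventually_ge_atTop 0] with T hT
    refine intervalIntegral.norm_integral_le_of_norm_le_const fun σ hσ => ?_
    rw [uIoc_of_le hcd] at hσ
    simpa [abs_mul, hs, abs_of_nonneg hT] using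
      hbound (σ + (s * T : ℝ) * Complex.I) (by simpa using hσ.1.le) (by simpa using hσ.2)
  have hrect : ∀ T : ℝ, (∫ σ in c..d, F (σ + ((-1) * T : ℝ) * Complex.I)) -
      (∫ σ in c..d, F (σ + (1 * T : ℝ) * Complex.I)) +
      Complex.I * (∫ η in (-T)..T, F (d + η * Complex.I)) -
      Complex.I * (∫ η in (-T)..T, F (c + η * Complex.I)) = 0 := by
    intro T
    have := Complex.integral_boundary_rect_eq_zero_of_differentiableOn F
      (c - T * Complex.I) (d + T * Complex.I) fun w hw => by
        have hw' := hw.1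
        simp [uIcc_of_le hcd] at hw'
        exact (hF w hw'.1 hw'.2).differentiableWithinAt
    simpa using this
  have hzero := tendsto_nhds_unique (tendsto_const_nhds.congr fun T => (hrect T).symm)
    ((((hside (-1) (by simp)).sub (hside 1 (by simp))).add
      ((hlim d hcd le_rfl).const_mul Complex.I)).sub ((hlim c le_rfl hcd).const_mul Complex.I))
  have : Complex.I * ((∫ η : ℝ, F (d + η * Complex.I)) - ∫ η : ℝ, F (c + η * Complex.I)) = 0 := by
    linear_combination -hzero
  exact (sub_eq_zero.1 ((mul_eq_zero.1 this).resolve_left Complex.I_ne_zero)).symm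

lemma differentiableAt_mbKernel (k j : ℕ) (y : ℂ) {w : ℂ} (hw : 0 < w.re) :
    DifferentiableAt ℂ (mbKernel k j y) w := by
  have hΓ : DifferentiableAt ℂ Complex.Gamma w := Complex.differentiableAt_Gamma w fun n h => by
    have := congrArg Complex.re h
    simp at this
    linarith [(Nat.cast_nonneg n : (0 : ℝ) ≤ n)]
  unfold mbKernel
  fun_prop

lemma continuous_mbKernel_vertical (k j : ℕ) (y : ℂ) {c : ℝ} (hc : 0 < c) :
    Continuous fun η : ℝ => mbKernel k j y (c - Complex.I * η) :=
  continuous_iff_continuousAt.2 fun η =>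
    ContinuousAt.comp (g := mbKernel k j y) (f := fun η : ℝ => (c - Complex.I * η : ℂ))
      (differentiableAt_mbKernel k j y (by simpa using hc)).continuousAt (by fun_prop)

lemma integrable_mbKernel {k : ℕ} (hk : 1 ≤ k) (j : ℕ) {c : ℝ} (hc : 0 < c) {y : ℂ}
    (hy : |y.im| < π / 2) : Integrable fun η : ℝ => mbKernel k j y (c - Complex.I * η) := by
  obtain ⟨K, b, hb, h⟩ := exists_norm_mbKernel_le hk j hc c hy |y.re|
  refine ((integrable_exp_neg_mul_abs hb).const_mul K).mono'
    (continuous_mbKernel_vertical k j y hc).aestronglyMeasurable (ae_of_all _ fun η => ?_)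
  simpa using h y (c - Complex.I * η) le_rfl le_rfl (by simp) (by simp)

lemma hasDerivAt_mbKernel (k j : ℕ) (y w : ℂ) :
    HasDerivAt (fun y => mbKernel k j y w) (-k * mbKernel k (j + 1) y w) y := by
  have h : (fun y => mbKernel k j y w) =
      fun y => w ^ j * Complex.Gamma w ^ k * Complex.exp (-(k * w * y)) := by
    ext y
    rw [mbKernel, mul_pow, ← Complex.exp_nat_mul]
    ring_nf
  rw [h]
  refine ((((hasDerivAt_id' y).const_mul (k * w)).fun_neg.cexp).const_mul
    (w ^ j * Complex.Gamma w ^ k)).congr_deriv ?_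
  rw [mbKernel, mul_pow, ← Complex.exp_nat_mul]
  ring_nf

lemma hasDerivAt_integral_mbKernel {k : ℕ} (hk : 1 ≤ k) (j : ℕ) {c : ℝ} (hc : 0 < c) {y : ℂ}
    (hy : |y.im| < π / 2) :
    HasDerivAt (fun y => ∫ η : ℝ, mbKernel k j y (c - Complex.I * η))
      (-k * ∫ η : ℝ, mbKernel k (j + 1) y (c - Complex.I * η)) y := by
  obtain ⟨δ, hyδ, hδ⟩ := exists_between hy
  obtain ⟨K, b, hb, h⟩ := exists_norm_mbKernel_le hk (j + 1) hc c hδ (|y.re| + 1)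
  have hs : {z : ℂ | |z.im| < δ ∧ |z.re| < |y.re| + 1} ∈ 𝓝 y :=
    ((isOpen_lt (f := fun z : ℂ => |z.im|) (by fun_prop) continuous_const).inter
      (isOpen_lt (f := fun z : ℂ => |z.re|) (by fun_prop) continuous_const)).mem_nhds
        ⟨hyδ, lt_add_one |y.re|⟩
  rw [← integral_const_mul]
  refine (hasDerivAt_integral_of_dominated_loc_of_deriv_le
    (bound := fun η : ℝ => k * (K * Real.exp (-b * |η|))) hs
    (.of_forall fun z => (continuous_mbKernel_vertical k j z hc).aestronglyMeasurable)
    (integrable_mbKernel hk j hc hy)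
    ((continuous_mbKernel_vertical k (j + 1) y hc).aestronglyMeasurable.const_mul _)
    (ae_of_all _ fun η z hz => ?_) (((integrable_exp_neg_mul_abs hb).const_mul K).const_mul _)
    (ae_of_all _ fun η z _ => hasDerivAt_mbKernel k j z _)).2
  rw [norm_mul, norm_neg, Complex.norm_natCast]
  gcongr
  simpa using h z (c - Complex.I * η) hz.1.le hz.2.le (by simp) (by simp)

lemma iteratedDeriv_integral_mbKernel {k : ℕ} (hk : 1 ≤ k) {c : ℝ} (hc : 0 < c) (n : ℕ) :
    ∀ y : ℂ, |y.im| < π / 2 →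
      iteratedDeriv n (fun y => ∫ η : ℝ, mbKernel k 0 y (c - Complex.I * η)) y =
        (-k) ^ n * ∫ η : ℝ, mbKernel k n y (c - Complex.I * η) := by
  induction n with
  | zero => simp
  | succ n ih =>
    intro y hy
    have hev : iteratedDeriv n (fun y => ∫ η : ℝ, mbKernel k 0 y (c - Complex.I * η)) =ᶠ[𝓝 y]
        fun y => (-k) ^ n * ∫ η : ℝ, mbKernel k n y (c - Complex.I * η) :=
      Filter.mem_of_superset ((isOpen_lt (f := fun z : ℂ => |z.im|) (by fun_prop)
        continuous_const).mem_nhds hy) ih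
    rw [iteratedDeriv_succ, hev.deriv_eq,
      ((hasDerivAt_integral_mbKernel hk n hc hy).const_mul _).deriv]
    ring

/-- The integral over a vertical line does not depend on the line. -/
lemma integral_mbKernel_eq_of_le {k : ℕ} (hk : 1 ≤ k) (j : ℕ) {c d : ℝ} (hc : 0 < c) (hcd : c ≤ d)
    {y : ℂ} (hy : |y.im| < π / 2) :
    ∫ η : ℝ, mbKernel k j y (c - Complex.I * η) =
      ∫ η : ℝ, mbKernel k j y (d - Complex.I * η) := by
  obtain ⟨K, b, hb, h⟩ := exists_norm_mbKernel_le hk j hc d hy |y.re|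
  have hflip : ∀ σ : ℝ, ∫ η : ℝ, mbKernel k j y (σ - Complex.I * η) =
      ∫ η : ℝ, mbKernel k j y (σ + η * Complex.I) := by
    intro σ
    rw [← integral_neg_eq_self fun η : ℝ => mbKernel k j y (σ - Complex.I * η)]
    congr with η
    push_cast
    ring_nf
  rw [hflip, hflip]
  exact integral_vertical_eq_of_norm_le hcd hb
    (fun w h1 _ => differentiableAt_mbKernel k j y (hc.trans_le h1))
    fun w h1 h2 => h y w le_rfl le_rfl h1 h2

lemma mbKernel_self {k : ℕ} (y : ℂ) {w : ℂ} (hw : w ≠ 0) :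
    mbKernel k k y w = Complex.exp (k * y) * mbKernel k 0 y (w + 1) := by
  rw [mbKernel, mbKernel, Complex.Gamma_add_one w hw, Complex.exp_nat_mul, ← mul_pow, pow_zero,
    one_mul, ← mul_pow,
    show -(w * y) = y + -((w + 1) * y) by ring, Complex.exp_add]
  ring

lemma integral_mbKernel_self {k : ℕ} (hk : 1 ≤ k) {c : ℝ} (hc : 0 < c) {y : ℂ}
    (hy : |y.im| < π / 2) :
    ∫ η : ℝ, mbKernel k k y (c - Complex.I * η) =
      Complex.exp (k * y) * ∫ η : ℝ, mbKernel k 0 y (c - Complex.I * η) := by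
  rw [integral_mbKernel_eq_of_le hk 0 hc (le_add_of_nonneg_right zero_le_one) hy,
    ← integral_const_mul]
  congr with η
  have hne : (c - Complex.I * η : ℂ) ≠ 0 := fun h => hc.ne' (by simpa using congrArg Complex.re h)
  rw [mbKernel_self y hne]
  push_cast
  ring_nf

lemma mbIntegrand_eq_mbKernel {k : ℕ} (hk : 1 ≤ k) (m : ℤ) (c : ℝ) (x : ℂ) (η : ℝ) :
    mbIntegrand k m c x η =
      mbKernel k 0 (x + Complex.I * ((k + 2 * m) * π / k : ℝ)) (c - Complex.I * η) := by
  have hk0 : (k : ℂ) ≠ 0 := by exact_mod_cast (Nat.one_le_iff_ne_zero.1 hk)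
  rw [mbIntegrand, mbKernel, mul_pow, ← Complex.exp_nat_mul, mul_assoc, ← Complex.exp_add, pow_zero,
    one_mul]
  congr 2
  push_cast
  field_simp
  ring

lemma abs_im_lt_of_mem_mbStrip {k : ℕ} {m : ℤ} {x : ℂ} (hx : x ∈ mbStrip k m) :
    |(x + Complex.I * ((k + 2 * m) * π / k : ℝ)).im| < π / 2 := by
  rw [Complex.add_im, Complex.I_mul_im, Complex.ofReal_re, abs_lt]
  exact ⟨by linarith [hx.1], by linarith [hx.2]⟩

lemma mbG_eq_integral_mbKernel {k : ℕ} (hk : 1 ≤ k) (m : ℤ) (c : ℝ) :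
    mbG k m c = fun x => (fun y => ∫ η : ℝ, mbKernel k 0 y (c - Complex.I * η))
      (x + Complex.I * ((k + 2 * m) * π / k : ℝ)) := by
  ext x
  simp only [mbG, mbIntegrand_eq_mbKernel hk]

/-- The factor picked up by the shift of the logarithmic variable. -/
lemma exp_mul_add_shift {k : ℕ} (hk : 1 ≤ k) (m : ℤ) (x : ℂ) :
    Complex.exp (k * (x + Complex.I * ((k + 2 * m) * π / k : ℝ))) =
      (-1) ^ k * Complex.exp (k * x) := by
  have hk0 : (k : ℂ) ≠ 0 := by exact_mod_cast (Nat.one_le_iff_ne_zero.1 hk)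
  rw [show (k * (x + Complex.I * ((k + 2 * m) * π / k : ℝ)) : ℂ) =
    k * x + k * (π * Complex.I) + m * (2 * π * Complex.I) by push_cast; field_simp; ring,
    Complex.exp_add, Complex.exp_add, Complex.exp_int_mul_two_pi_mul_I,
    Complex.exp_nat_mul (π * Complex.I), Complex.exp_pi_mul_I]
  ring

/-- **Lemma 5 of the paper, parts (a), (b).** The Mellin–Barnes integrand is integrable on
the strip, and the integral `G` is holomorphic there and solves the generalized
hypergeometric equation in logarithmic form `G^{(k)}(x) = k^k e^{kx} G(x)`. -/
theorem mellin_barnes_solution (k : ℕ) (hk : 1 ≤ k) (m : ℤ) (c : ℝ) (hc : 0 < c) :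
    (∀ x ∈ mbStrip k m, Integrable (mbIntegrand k m c x)) ∧
    DifferentiableOn ℂ (mbG k m c) (mbStrip k m) ∧
    ∀ x ∈ mbStrip k m,
      iteratedDeriv k (mbG k m c) x = (k : ℂ) ^ k * Complex.exp (k * x) * mbG k m c x := by
  have hG := mbG_eq_integral_mbKernel hk m c
  refine ⟨fun x hx => ?_, fun x hx => ?_, fun x hx => ?_⟩
  · simpa only [← mbIntegrand_eq_mbKernel hk] using
      integrable_mbKernel hk 0 hc (abs_im_lt_of_mem_mbStrip hx)
  · rw [hG]
    exact ((hasDerivAt_integral_mbKernel hk 0 hc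
      (abs_im_lt_of_mem_mbStrip hx)).comp_add_const x _).differentiableAt.differentiableWithinAt
  · have hy := abs_im_lt_of_mem_mbStrip hx
    rw [hG, iteratedDeriv_comp_add_const k
      (fun y => ∫ η : ℝ, mbKernel k 0 y (c - Complex.I * η))]
    simp only
    rw [iteratedDeriv_integral_mbKernel hk hc k _ hy, integral_mbKernel_self hk hc hy,
      exp_mul_add_shift hk, ← mul_assoc, ← mul_assoc, ← mul_pow, neg_mul_neg, mul_one]
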